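/- Let π₁ ∈ [1/3, 1/2), π₃ = 1/2 − π₁, and τ ∈ [−1, 1]. For n a positive multiple of 6, define A(n) = Σ_{q=1}^{n/6−1} n!/(((n/2−q)!)²·(q!)²) · π₁^{n−2q} · π₃^{2q} · ( −(1/2)·( (−n/2 + q)·τ + 2q ) + (π₃/π₁)·(−n/2 + q) ). Then: if π₁ > 2/(4+τ), there exist constants 0 < c₁ ≤ c₂ and N such that c₁ ≤ A(n) ≤ c₂ for all such n > N; if π₁ < 2/(4+τ), there exist constants 0 < c₁ ≤ c₂ and N such that −c₂ ≤ A(n) ≤ −c₁ for all such n > N; and if π₁ = 2/(4+τ), there exist C > 0 and N such that |A(n)| ≤ C/n for all such n > N. -/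

import Mathlib

/-- The weighted sum `A(n)` of symmetric multinomial probabilities. -/
noncomputable def Aseq (π₁ π₃ τ : ℝ) (n : ℕ) : ℝ :=
  ∑ q ∈ Finset.Icc 1 (n / 6 - 1),
    (n.factorial : ℝ) / (((n / 2 - q).factorial : ℝ) ^ 2 * (q.factorial : ℝ) ^ 2) *
      π₁ ^ (n - 2 * q) * π₃ ^ (2 * q) *
      (-(1 / 2) * ((-(n : ℝ) / 2 + q) * τ + 2 * q) + π₃ / π₁ * (-(n : ℝ) / 2 + q))

/-- The probability that a binomial variable with parameters `m` and `y` equals `q`. -/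
noncomputable def binomWeight (y : ℝ) (m q : ℕ) : ℝ :=
  (m.choose q : ℝ) * y ^ q * (1 - y) ^ (m - q)

namespace binomWeight

variable {y : ℝ} {m p q : ℕ}

lemma nonneg (h0 : 0 ≤ y) (h1 : y ≤ 1) (m q : ℕ) : 0 ≤ binomWeight y m q := by
  have : 0 ≤ 1 - y := by linarith
  unfold binomWeight
  positivity

lemma sum_eq_one (y : ℝ) (m : ℕ) : ∑ q ∈ Finset.range (m + 1), binomWeight y m q = 1 := by
  have h := congrArg (Polynomial.eval y) (bernsteinPolynomial.sum ℝ m)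
  simpa [Polynomial.eval_finsetSum, bernsteinPolynomial, binomWeight] using h

lemma variance (y : ℝ) (m : ℕ) :
    ∑ q ∈ Finset.range (m + 1), ((q : ℝ) - m * y) ^ 2 * binomWeight y m q =
      m * y * (1 - y) := by
  have h := congrArg (Polynomial.eval y) (bernsteinPolynomial.variance ℝ m)
  simp only [Polynomial.eval_finsetSum, bernsteinPolynomial, nsmul_eq_mul, Polynomial.eval_mul,
    Polynomial.eval_pow, Polynomial.eval_sub, Polynomial.eval_natCast, Polynomial.eval_X,
    Polynomial.eval_one] at h
  rw [← h]
  refine Finset.sum_congr rfl fun q _ => ?_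
  unfold binomWeight
  ring

lemma succ_mul (y : ℝ) (hq : q ≤ m) :
    ((q : ℝ) + 1) * (1 - y) * binomWeight y m (q + 1) = ((m : ℝ) - q) * y * binomWeight y m q := by
  rcases hq.eq_or_lt with rfl | hq
  · simp [binomWeight]
  · have h := congrArg (Nat.cast : ℕ → ℝ) (Nat.choose_succ_right_eq m q)
    push_cast [hq.le] at h
    obtain ⟨r, rfl⟩ := Nat.exists_eq_add_of_lt hq
    have e1 : q + r + 1 - (q + 1) = r := by omega
    have e2 : q + r + 1 - q = r + 1 := by omega
    unfold binomWeight
    rw [e1, e2, pow_succ y, pow_succ (1 - y)]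
    linear_combination (y ^ q * y * (1 - y) ^ r * (1 - y)) * h

lemma le_succ (h0 : 0 < y) (h1 : y < 1) (hq : (q : ℝ) + 1 ≤ m * y) :
    binomWeight y m q ≤ binomWeight y m (q + 1) := by
  have hqm : (q : ℝ) ≤ m := by nlinarith [(Nat.cast_nonneg m : (0 : ℝ) ≤ m)]
  have h := succ_mul y (Nat.cast_le.mp hqm)
  have hb := nonneg h0.le h1.le m q
  have hpos : 0 < ((q : ℝ) + 1) * (1 - y) := mul_pos (by positivity) (by linarith)
  have hle : ((q : ℝ) + 1) * (1 - y) ≤ ((m : ℝ) - q) * y := by nlinarith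
  refine le_of_mul_le_mul_left ?_ hpos
  rw [h]
  exact mul_le_mul_of_nonneg_right hle hb

lemma mono (h0 : 0 < y) (h1 : y < 1) (hqp : q ≤ p) (hp : (p : ℝ) ≤ m * y) :
    binomWeight y m q ≤ binomWeight y m p := by
  induction p, hqp using Nat.le_induction with
  | base => exact le_rfl
  | succ r hr ih =>
    push_cast at hp
    exact (ih (by linarith)).trans (le_succ h0 h1 hp)

lemma succ_le (h0 : 0 < y) (h1 : y < 1) (hqm : q ≤ m) (hq : m * y ≤ (q : ℝ)) :
    binomWeight y m (q + 1) ≤ binomWeight y m q := by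
  have h := succ_mul y hqm
  have hb := nonneg h0.le h1.le m q
  have hpos : 0 < ((q : ℝ) + 1) * (1 - y) := mul_pos (by positivity) (by linarith)
  have hle : ((m : ℝ) - q) * y ≤ ((q : ℝ) + 1) * (1 - y) := by nlinarith
  refine le_of_mul_le_mul_left ?_ hpos
  rw [h]
  exact mul_le_mul_of_nonneg_right hle hb

lemma le_two_mul (h0 : 0 < y) (h1 : y < 1) (hv : 4 ≤ m * y * (1 - y)) (hp : (p : ℝ) ≤ m * y)
    (hp' : m * y < p + 1) (hqm : q ≤ m) : binomWeight y m q ≤ 2 * binomWeight y m p := by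
  have hbp := nonneg h0.le h1.le m p
  have hm : (0 : ℝ) ≤ m := Nat.cast_nonneg m
  rcases le_or_gt q p with hqp | hqp
  · have := mono h0 h1 hqp hp
    linarith
  · have hstep : binomWeight y m (p + 1) ≤ 2 * binomWeight y m p := by
      have h := succ_mul (m := m) (q := p) y (by omega)
      have hx : 0 < 1 - y := by linarith
      have hpos : 0 < ((p : ℝ) + 1) * (1 - y) := by positivity
      have hle : ((m : ℝ) - p) * y ≤ ((p : ℝ) + 1) * (1 - y) * 2 := by nlinarith
      refine le_of_mul_le_mul_left ?_ hpos
      rw [h, ← mul_assoc]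
      exact mul_le_mul_of_nonneg_right hle hbp
    induction q, hqp using Nat.le_induction with
    | base => exact hstep
    | succ r hr ih =>
      refine (succ_le h0 h1 (by omega) ?_).trans (ih (by omega))
      have : ((p + 1 : ℕ) : ℝ) ≤ r := Nat.cast_le.mpr hr
      push_cast at this
      linarith

lemma le_of_le_mode (h0 : 0 < y) (h1 : y < 1) (hp : (p : ℝ) ≤ m * y)
    (hp' : m * y < p + 1) {J : ℕ} (hJp : J ≤ p) {j : ℕ} (hj : j ≤ J) :
    (1 - (J + 1) / (m * y * (1 - y)) * j) * binomWeight y m p ≤ binomWeight y m (p - j) := by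
  have hx : 0 < 1 - y := by linarith
  rcases Nat.eq_zero_or_pos m with rfl | hm
  · simp only [Nat.cast_zero, zero_mul] at hp
    have : p = 0 := by exact_mod_cast le_antisymm hp (Nat.cast_nonneg p)
    obtain rfl : j = 0 := by omega
    simp
  have hm' : (0 : ℝ) < m := Nat.cast_pos.mpr hm
  have hv : 0 < m * y * (1 - y) := by positivity
  set a : ℝ := (J + 1) / (m * y * (1 - y)) with ha
  have ha0 : 0 ≤ a := by positivity
  have hav : a * (m * y * (1 - y)) = J + 1 := div_mul_cancel₀ _ hv.ne'
  have hbp := nonneg h0.le h1.le m p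
  induction j with
  | zero => simp
  | succ j ih =>
    have ih := ih (by omega)
    obtain ⟨q, hq⟩ : ∃ q, p = q + 1 + j := ⟨p - (j + 1), by omega⟩
    have e1 : p - j = q + 1 := by omega
    have e2 : p - (j + 1) = q := by omega
    rw [e1] at ih
    rw [e2]
    have hpm : p ≤ m := by
      have : (p : ℝ) ≤ m := by nlinarith
      exact_mod_cast this
    have h := succ_mul (m := m) (q := q) y (by omega)
    have hpq : (p : ℝ) = q + 1 + j := by rw [hq]; push_cast; ring
    have hjJ : (j : ℝ) + 1 ≤ J := by exact_mod_cast hj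
    have hbq := nonneg h0.le h1.le m q
    have hbq1 := nonneg h0.le h1.le m (q + 1)
    have hj0 : (0 : ℝ) ≤ j := Nat.cast_nonneg j
    have hmq : m * (1 - y) ≤ (m : ℝ) - q := by linarith
    have hmq0 : 0 < ((m : ℝ) - q) * y := by
      have : 0 < m * (1 - y) := by positivity
      exact mul_pos (by linarith) h0
    have hdiff : (1 - a) * (((m : ℝ) - q) * y) ≤ ((q : ℝ) + 1) * (1 - y) := by
      have h2 : a * (m * y * (1 - y)) ≤ a * (((m : ℝ) - q) * y) := by
        apply mul_le_mul_of_nonneg_left _ ha0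
        nlinarith
      nlinarith
    have hstep : (1 - a) * binomWeight y m (q + 1) ≤ binomWeight y m q := by
      refine le_of_mul_le_mul_left ?_ hmq0
      rw [← h]
      nlinarith [mul_le_mul_of_nonneg_right hdiff hbq1]
    rcases le_or_gt a 1 with h5 | h5
    · have := mul_le_mul_of_nonneg_left ih (by linarith : 0 ≤ 1 - a)
      have h6 : 0 ≤ a * a * j * binomWeight y m p := by positivity
      push_cast
      nlinarith
    · have : (1 - a * ((j + 1 : ℕ) : ℝ)) ≤ 0 := by push_cast; nlinarith
      exact (mul_nonpos_of_nonpos_of_nonneg this hbp).trans hbq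

/-- A block of `J` consecutive integers just below the mode, on which the weights are at least
half of the maximal one. -/
lemma exists_block (h0 : 0 < y) (h1 : y < 1) (hv : 4 ≤ m * y * (1 - y)) (hp : (p : ℝ) ≤ m * y)
    (hp' : m * y < p + 1) :
    ∃ J : ℕ, √(m * y * (1 - y)) / 4 ≤ J ∧ J < p ∧
      ∀ q ∈ Finset.Ico (p - J) p, binomWeight y m p / 2 ≤ binomWeight y m q := by
  set v : ℝ := m * y * (1 - y) with hvdef
  have hs : 2 ≤ √v := Real.le_sqrt_of_sq_le (by norm_num; exact hv)
  have hss : √v * √v = v := Real.mul_self_sqrt (by linarith)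
  have hm : (0 : ℝ) ≤ m := Nat.cast_nonneg m
  have hJle := Nat.floor_le (by positivity : 0 ≤ √v / 2)
  have hJlt := Nat.lt_floor_add_one (√v / 2)
  set J := ⌊√v / 2⌋₊
  have hJ1 : (1 : ℝ) ≤ J := by
    have : 1 ≤ J := Nat.le_floor (by push_cast; linarith)
    exact_mod_cast this
  have hvm : v ≤ m * y := by nlinarith [mul_nonneg hm h0.le]
  have hJp : J < p := by
    have : (J : ℝ) < p := by nlinarith
    exact_mod_cast this
  refine ⟨J, by linarith, hJp, fun q hq => ?_⟩
  rw [Finset.mem_Ico] at hq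
  have h := le_of_le_mode h0 h1 hp hp' hJp.le (j := p - q) (by omega)
  rw [show p - (p - q) = q by omega, ← hvdef] at h
  refine le_trans ?_ h
  have hb := nonneg h0.le h1.le m p
  have hj : ((p - q : ℕ) : ℝ) ≤ J := by exact_mod_cast (by omega)
  have h2 : ((J : ℝ) + 1) / v * ((p - q : ℕ) : ℝ) ≤ 1 / 2 := by
    rw [div_mul_eq_mul_div, div_le_iff₀ (by linarith)]
    have : ((J : ℝ) + 1) * ((p - q : ℕ) : ℝ) ≤ (J + 1) * J :=
      mul_le_mul_of_nonneg_left hj (by positivity)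
    nlinarith
  nlinarith

lemma mode_le (h0 : 0 < y) (h1 : y < 1) (hv : 4 ≤ m * y * (1 - y)) (hp : (p : ℝ) ≤ m * y)
    (hp' : m * y < p + 1) : √(m * y * (1 - y)) * binomWeight y m p ≤ 8 := by
  obtain ⟨J, hJ, hJp, hb⟩ := exists_block h0 h1 hv hp hp'
  have hpm : p ≤ m := by
    have : (p : ℝ) ≤ m := by nlinarith [(Nat.cast_nonneg m : (0 : ℝ) ≤ m)]
    exact_mod_cast this
  have hcard := Finset.card_nsmul_le_sum _ _ _ hb
  rw [Nat.card_Ico, show p - (p - J) = J by omega, nsmul_eq_mul] at hcard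
  have hsub : ∑ q ∈ Finset.Ico (p - J) p, binomWeight y m q ≤ 1 := by
    rw [← sum_eq_one y m]
    refine Finset.sum_le_sum_of_subset_of_nonneg (fun q hq => ?_)
      fun q _ _ => nonneg h0.le h1.le m q
    simp only [Finset.mem_Ico, Finset.mem_range] at hq ⊢
    omega
  nlinarith [nonneg h0.le h1.le m p]

lemma le_mode (h0 : 0 < y) (h1 : y < 1) (hv : 4 ≤ m * y * (1 - y)) (hp : (p : ℝ) ≤ m * y)
    (hp' : m * y < p + 1) : 3 / 40 ≤ √(m * y * (1 - y)) * binomWeight y m p := by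
  set v : ℝ := m * y * (1 - y) with hvdef
  have hs : 2 ≤ √v := Real.le_sqrt_of_sq_le (by norm_num; exact hv)
  have hss : √v * √v = v := Real.mul_self_sqrt (by linarith)
  have hm : (0 : ℝ) ≤ m := Nat.cast_nonneg m
  have hbp := nonneg h0.le h1.le m p
  have hcheb : ∑ q ∈ Finset.range (m + 1),
      (binomWeight y m q - ((q : ℝ) - m * y) ^ 2 * binomWeight y m q / (4 * v)) = 3 / 4 := by
    rw [Finset.sum_sub_distrib, sum_eq_one, ← Finset.sum_div, variance, ← hvdef]
    field_simp
    norm_num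
  set T := Finset.Icc ⌈m * y - 2 * √v⌉₊ ⌊m * y + 2 * √v⌋₊ with hT
  have hle : ∀ q ∈ Finset.range (m + 1),
      (binomWeight y m q - ((q : ℝ) - m * y) ^ 2 * binomWeight y m q / (4 * v)) ≤
        if q ∈ T then 2 * binomWeight y m p else 0 := by
    intro q hq
    have hbq := nonneg h0.le h1.le m q
    split_ifs with hqT
    · have h2 := le_two_mul h0 h1 hv hp hp' (q := q) (by simp at hq; omega)
      have : 0 ≤ ((q : ℝ) - m * y) ^ 2 * binomWeight y m q / (4 * v) := by positivity
      linarith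
    · have hd : 4 * v ≤ ((q : ℝ) - m * y) ^ 2 := by
        by_contra! hlt
        have habs := abs_lt_of_sq_lt_sq (show ((q : ℝ) - m * y) ^ 2 < (2 * √v) ^ 2 by nlinarith)
          (by positivity)
        rw [abs_lt] at habs
        apply hqT
        rw [hT, Finset.mem_Icc, Nat.ceil_le]
        exact ⟨by linarith, Nat.le_floor (by linarith)⟩
      rw [sub_nonpos, le_div_iff₀ (by linarith), mul_comm]
      exact mul_le_mul_of_nonneg_right hd hbq
  have hsum := Finset.sum_le_sum hle
  rw [hcheb, ← Finset.sum_filter, Finset.sum_const, nsmul_eq_mul] at hsum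
  have hcard : (((Finset.range (m + 1)).filter (· ∈ T)).card : ℝ) ≤ 4 * √v + 1 := by
    have h2 : ((Finset.range (m + 1)).filter (· ∈ T)).card ≤ T.card :=
      Finset.card_le_card fun q hq => (Finset.mem_filter.mp hq).2
    have h3 : (T.card : ℝ) ≤ 4 * √v + 1 := by
      rw [hT, Nat.card_Icc]
      have hf := Nat.floor_le (by positivity : 0 ≤ m * y + 2 * √v)
      have hc := Nat.le_ceil (m * y - 2 * √v)
      rcases le_total ⌈m * y - 2 * √v⌉₊ (⌊m * y + 2 * √v⌋₊ + 1) with h | h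
      · rw [Nat.cast_sub h]
        push_cast
        linarith
      · rw [Nat.sub_eq_zero_of_le h]
        push_cast
        linarith
    exact le_trans (Nat.cast_le.mpr h2) h3
  nlinarith [mul_le_mul_of_nonneg_right hcard hbp]

lemma le_sum_sq (h0 : 0 < y) (h1 : y < 1) (hv : 4 ≤ m * y * (1 - y)) {r : ℕ}
    (hr : m * y ≤ r) : 1 / 4096 ≤
      √(m * y * (1 - y)) * ∑ q ∈ Finset.Ico 1 r, binomWeight y m q ^ 2 := by
  have hm : (0 : ℝ) ≤ m := Nat.cast_nonneg m
  have hp := Nat.floor_le (by positivity : 0 ≤ m * y)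
  have hp' := Nat.lt_floor_add_one (m * y)
  set p := ⌊m * y⌋₊
  obtain ⟨J, hJ, hJp, hb⟩ := exists_block h0 h1 hv hp hp'
  have hmode := le_mode h0 h1 hv hp hp'
  have hbp := nonneg h0.le h1.le m p
  have hpr : p ≤ r := by exact_mod_cast hp.trans hr
  have hb2 : ∀ q ∈ Finset.Ico (p - J) p, (binomWeight y m p / 2) ^ 2 ≤ binomWeight y m q ^ 2 :=
    fun q hq => pow_le_pow_left₀ (by positivity) (hb q hq) 2
  have hcard := Finset.card_nsmul_le_sum _ _ _ hb2
  rw [Nat.card_Ico, show p - (p - J) = J by omega, nsmul_eq_mul] at hcard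
  have hsub : ∑ q ∈ Finset.Ico (p - J) p, binomWeight y m q ^ 2 ≤
      ∑ q ∈ Finset.Ico 1 r, binomWeight y m q ^ 2 :=
    Finset.sum_le_sum_of_subset_of_nonneg (Finset.Ico_subset_Ico (by omega) hpr)
      fun q _ _ => sq_nonneg _
  set s := √(m * y * (1 - y))
  have hs : 0 ≤ s := Real.sqrt_nonneg _
  have h2 : s / 4 * (binomWeight y m p / 2) ^ 2 ≤ ∑ q ∈ Finset.Ico 1 r, binomWeight y m q ^ 2 :=
    (mul_le_mul_of_nonneg_right hJ (by positivity)).trans (hcard.trans hsub)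
  have h3 := mul_le_mul_of_nonneg_left h2 hs
  have h4 : (3 / 40 : ℝ) ^ 2 ≤ (s * binomWeight y m p) ^ 2 :=
    pow_le_pow_left₀ (by norm_num) hmode 2
  nlinarith

lemma sum_sq_le (h0 : 0 < y) (h1 : y < 1) (hv : 4 ≤ m * y * (1 - y)) {r : ℕ} (hr : r ≤ m) :
    √(m * y * (1 - y)) * ∑ q ∈ Finset.Ico 1 r, binomWeight y m q ^ 2 ≤ 16 := by
  have hm : (0 : ℝ) ≤ m := Nat.cast_nonneg m
  have hp := Nat.floor_le (by positivity : 0 ≤ m * y)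
  have hp' := Nat.lt_floor_add_one (m * y)
  set p := ⌊m * y⌋₊
  have hmode := mode_le h0 h1 hv hp hp'
  have h2 : ∑ q ∈ Finset.Ico 1 r, binomWeight y m q ^ 2 ≤ 2 * binomWeight y m p := by
    calc ∑ q ∈ Finset.Ico 1 r, binomWeight y m q ^ 2
        ≤ ∑ q ∈ Finset.range (m + 1), binomWeight y m q ^ 2 := by
          refine Finset.sum_le_sum_of_subset_of_nonneg (fun q hq => ?_) fun q _ _ => sq_nonneg _
          simp only [Finset.mem_Ico, Finset.mem_range] at hq ⊢
          omega
      _ ≤ ∑ q ∈ Finset.range (m + 1), 2 * binomWeight y m p * binomWeight y m q := by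
          refine Finset.sum_le_sum fun q hq => ?_
          rw [sq]
          refine mul_le_mul_of_nonneg_right ?_ (nonneg h0.le h1.le m q)
          exact le_two_mul h0 h1 hv hp hp' (by simp at hq; omega)
      _ = 2 * binomWeight y m p := by rw [← Finset.mul_sum, sum_eq_one, mul_one]
  nlinarith [mul_le_mul_of_nonneg_left h2 (Real.sqrt_nonneg (m * y * (1 - y)))]

lemma sum_sq_mul_dev (y : ℝ) {r : ℕ} (hr1 : 1 ≤ r) (hr : r ≤ m) :
    ∑ q ∈ Finset.Ico 1 r,
      binomWeight y m q ^ 2 * ((q - m * y) * (q * (1 - y) + (m - q) * y)) =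
      (1 * (1 - y) * binomWeight y m 1) ^ 2 - (r * (1 - y) * binomWeight y m r) ^ 2 := by
  induction r, hr1 using Nat.le_induction with
  | base => simp
  | succ q hq ih =>
    have h := succ_mul (m := m) (q := q) y (by omega)
    rw [Finset.sum_Ico_succ_top hq, ih (by omega)]
    push_cast
    rw [h]
    ring

lemma sum_sq_mul_sq_dev (y : ℝ) {r : ℕ} (hr1 : 1 ≤ r) (hr : r ≤ m) :
    ∑ q ∈ Finset.Ico 1 r, (binomWeight y m q ^ 2 *
      ((q - m * y) ^ 2 * (q * (1 - y) + (m - q) * y) - ((m - q) * y) ^ 2)) =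
      (1 * (1 - y) * binomWeight y m 1) ^ 2 * (1 - m * y) -
        (r * (1 - y) * binomWeight y m r) ^ 2 * (r - m * y) := by
  induction r, hr1 using Nat.le_induction with
  | base => simp
  | succ q hq ih =>
    have h := succ_mul (m := m) (q := q) y (by omega)
    rw [Finset.sum_Ico_succ_top hq, ih (by omega)]
    push_cast
    rw [h]
    ring

lemma sum_sq_mul_sq_dev_le (h0 : 0 < y) (h1 : y ≤ 1 / 2) {r : ℕ} (hr1 : 1 ≤ r) (hr : r ≤ m)
    (hmy : 1 ≤ m * y) (hmr : m * y ≤ r) :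
    ∑ q ∈ Finset.Ico 1 r, binomWeight y m q ^ 2 * (q - m * y) ^ 2 ≤
      m * y * ∑ q ∈ Finset.Ico 1 r, binomWeight y m q ^ 2 := by
  have hid := sum_sq_mul_sq_dev (m := m) y hr1 hr
  have hneg : (1 * (1 - y) * binomWeight y m 1) ^ 2 * (1 - m * y) -
      (r * (1 - y) * binomWeight y m r) ^ 2 * (r - m * y) ≤ 0 := by
    have e1 := mul_nonneg (sq_nonneg (1 * (1 - y) * binomWeight y m 1)) (sub_nonneg.mpr hmy)
    have e2 := mul_nonneg (sq_nonneg (r * (1 - y) * binomWeight y m r)) (sub_nonneg.mpr hmr)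
    linarith
  rw [← hid] at hneg
  have hle : ∑ q ∈ Finset.Ico 1 r, (m * y * (binomWeight y m q ^ 2 * (q - m * y) ^ 2) -
      (m * y) * (m * y * binomWeight y m q ^ 2)) ≤ 0 := by
    refine le_trans (Finset.sum_le_sum fun q hq => ?_) hneg
    rw [Finset.mem_Ico] at hq
    have hqm : (q : ℝ) ≤ m := by exact_mod_cast (by omega)
    have hq0 : (0 : ℝ) ≤ q := Nat.cast_nonneg q
    have e1 : m * y ≤ q * (1 - y) + (m - q) * y := by nlinarith
    have e2 : ((m - q) * y) ^ 2 ≤ (m * y) ^ 2 := by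
      apply pow_le_pow_left₀ (mul_nonneg (by linarith) h0.le)
      nlinarith
    have e3 := mul_le_mul_of_nonneg_left e1 (sq_nonneg ((q : ℝ) - m * y))
    have e4 : (q - m * y) ^ 2 * (m * y) - (m * y) ^ 2 ≤
      (q - m * y) ^ 2 * (q * (1 - y) + (m - q) * y) - ((m - q) * y) ^ 2 := by linarith
    nlinarith [mul_le_mul_of_nonneg_left e4 (sq_nonneg (binomWeight y m q))]
  rw [Finset.sum_sub_distrib, ← Finset.mul_sum, ← Finset.mul_sum, ← Finset.mul_sum, ← mul_sub]
    at hle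
  have := nonpos_of_mul_nonpos_right hle (by linarith)
  linarith

lemma abs_sum_sq_mul_dev_le (h0 : 0 < y) (h1 : y ≤ 1 / 2) {r : ℕ} (hr1 : 1 ≤ r) (hr : r ≤ m)
    (hmy : 1 ≤ m * y) (hmr : m * y ≤ r) :
    |∑ q ∈ Finset.Ico 1 r, binomWeight y m q ^ 2 * (q - m * y)| ≤
      √m * ∑ q ∈ Finset.Ico 1 r, binomWeight y m q ^ 2 := by
  have hV := sum_sq_mul_sq_dev_le h0 h1 hr1 hr hmy hmr
  set S := ∑ q ∈ Finset.Ico 1 r, binomWeight y m q ^ 2 with hS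
  have hS0 : 0 ≤ S := Finset.sum_nonneg fun q _ => sq_nonneg _
  have hm : (0 : ℝ) ≤ m := Nat.cast_nonneg m
  have hcs := Finset.sum_mul_sq_le_sq_mul_sq (Finset.Ico 1 r) (fun q => binomWeight y m q)
    fun q => binomWeight y m q * (q - m * y)
  apply abs_le_of_sq_le_sq _ (by positivity)
  rw [mul_pow, Real.sq_sqrt hm]
  simp only [mul_pow, ← mul_assoc, ← sq, ← hS] at hcs
  refine hcs.trans ((mul_le_mul_of_nonneg_left hV hS0).trans ?_)
  nlinarith [mul_nonneg hm (sq_nonneg S)]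

lemma le_one (h0 : 0 ≤ y) (h1 : y ≤ 1) (hq : q ≤ m) : binomWeight y m q ≤ 1 := by
  rw [← sum_eq_one y m]
  exact Finset.single_le_sum (fun q _ => nonneg h0 h1 m q) (Finset.mem_range.mpr (by omega))

lemma sq_dev_mul_le (h0 : 0 ≤ y) (h1 : y ≤ 1) (hq : q ≤ m) :
    (q - m * y) ^ 2 * binomWeight y m q ≤ m * y * (1 - y) := by
  rw [← variance y m]
  exact Finset.single_le_sum (f := fun q : ℕ => ((q : ℝ) - m * y) ^ 2 * binomWeight y m q)
    (fun q _ => mul_nonneg (sq_nonneg _) (nonneg h0 h1 m q)) (Finset.mem_range.mpr (by omega))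

lemma abs_sum_sq_mul_dev_le_of_lt (h0 : 0 < y) (h1 : y ≤ 1 / 2) {r : ℕ} (hr1 : 1 ≤ r)
    (hr : r ≤ m) (hmy : 1 ≤ m * y) {ε : ℝ} (hε : 0 < ε) (hmr : m * y + m * ε ≤ r) :
    2 * m * y * (1 - y) * |∑ q ∈ Finset.Ico 1 r, binomWeight y m q ^ 2 * (q - m * y)| ≤
      m * y * ∑ q ∈ Finset.Ico 1 r, binomWeight y m q ^ 2 + (1 + 1 / ε ^ 4) := by
  have hm : (1 : ℝ) ≤ m := by exact_mod_cast hr1.trans hr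
  have hmε : 0 < m * ε := by positivity
  have hV := sum_sq_mul_sq_dev_le h0 h1 hr1 hr hmy (by linarith)
  have hid := sum_sq_mul_dev (m := m) y hr1 hr
  have hV0 : 0 ≤ ∑ q ∈ Finset.Ico 1 r, binomWeight y m q ^ 2 * (q - m * y) ^ 2 :=
    Finset.sum_nonneg fun q _ => by positivity
  set S := ∑ q ∈ Finset.Ico 1 r, binomWeight y m q ^ 2
  have hsplit : ∑ q ∈ Finset.Ico 1 r,
      binomWeight y m q ^ 2 * ((q - m * y) * (q * (1 - y) + (m - q) * y)) =
      2 * m * y * (1 - y) * ∑ q ∈ Finset.Ico 1 r, binomWeight y m q ^ 2 * (q - m * y) +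
      (1 - 2 * y) * ∑ q ∈ Finset.Ico 1 r, binomWeight y m q ^ 2 * (q - m * y) ^ 2 := by
    rw [Finset.mul_sum, Finset.mul_sum, ← Finset.sum_add_distrib]
    refine Finset.sum_congr rfl fun q _ => ?_
    ring
  set D := ∑ q ∈ Finset.Ico 1 r, binomWeight y m q ^ 2 * (q - m * y)
  set V := ∑ q ∈ Finset.Ico 1 r, binomWeight y m q ^ 2 * (q - m * y) ^ 2
  have hy1 : y ≤ 1 := by linarith
  have hx : 0 ≤ 1 - y := by linarith
  have g1 : (1 * (1 - y) * binomWeight y m 1) ^ 2 ≤ 1 := by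
    have := nonneg h0.le hy1 m 1
    apply pow_le_one₀ (by positivity)
    rw [one_mul]
    exact mul_le_one₀ (by linarith) this (le_one h0.le hy1 (hr1.trans hr))
  have gr : (r * (1 - y) * binomWeight y m r) ^ 2 ≤ 1 / ε ^ 4 := by
    have hb := nonneg h0.le hy1 m r
    have hrm : (r : ℝ) ≤ m := by exact_mod_cast hr
    have e1 := sq_dev_mul_le h0.le hy1 hr
    have e2 : (m * ε) ^ 2 ≤ (r - m * y) ^ 2 := pow_le_pow_left₀ hmε.le (by linarith) 2
    have e3 : (m * ε) ^ 2 * binomWeight y m r ≤ m * 1 * 1 := by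
      refine ((mul_le_mul_of_nonneg_right e2 hb).trans e1).trans ?_
      gcongr
      linarith
    have e4 : m * binomWeight y m r ≤ 1 / ε ^ 2 := by
      rw [le_div_iff₀ (by positivity)]
      refine le_of_mul_le_mul_left ?_ (by linarith : (0 : ℝ) < m)
      nlinarith
    have e5 : r * (1 - y) * binomWeight y m r ≤ 1 / ε ^ 2 := by
      refine le_trans (mul_le_mul_of_nonneg_right ?_ hb) e4
      nlinarith [(Nat.cast_nonneg r : (0 : ℝ) ≤ r)]
    refine (pow_le_pow_left₀ (by positivity) e5 2).trans_eq ?_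
    rw [div_pow, ← pow_mul, one_pow]
  have hpos : 0 ≤ 2 * m * y * (1 - y) := by positivity
  rw [← abs_of_nonneg hpos, ← abs_mul, abs_le]
  have hg1 := sq_nonneg (1 * (1 - y) * binomWeight y m 1)
  have hgr := sq_nonneg (r * (1 - y) * binomWeight y m r)
  have hyV : 0 ≤ y * V := by positivity
  have h2V : 0 ≤ (1 - 2 * y) * V := mul_nonneg (by linarith) hV0
  have hS0 : 0 ≤ m * y * S := hV0.trans hV
  have : 0 ≤ 1 / ε ^ 4 := by positivity
  constructor <;> linarith

end binomWeight

/-- The product of the central binomial probability with the truncated sum of squared binomial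
weights is of exact order `1 / m`, where `m = 3 * k`. -/
lemma exists_bounds_central_mul_sum_sq {y : ℝ} (h0 : 0 < y) (h1 : y ≤ 1 / 3) :
    ∃ α β : ℝ, 0 < α ∧ 0 < β ∧ ∃ K : ℕ, ∀ k : ℕ, K ≤ k → 1 ≤ ((3 * k : ℕ) : ℝ) * y ∧
      α ≤ ((3 * k : ℕ) : ℝ) * (binomWeight (1 / 2) (2 * (3 * k)) (3 * k) *
        ∑ q ∈ Finset.Ico 1 k, binomWeight y (3 * k) q ^ 2) ∧
      ((3 * k : ℕ) : ℝ) * (binomWeight (1 / 2) (2 * (3 * k)) (3 * k) *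
        ∑ q ∈ Finset.Ico 1 k, binomWeight y (3 * k) q ^ 2) ≤ β := by
  have hx : 0 < 1 - y := by linarith
  have hxy : 0 < y * (1 - y) := mul_pos h0 hx
  set w := √(y * (1 - y) / 2)
  have hw0 : 0 < w := Real.sqrt_pos.mpr (by positivity)
  refine ⟨3 / 40 * (1 / 4096) / w, 8 * 16 / w, by positivity, by positivity,
    ⌈4 / (y * (1 - y))⌉₊, fun k hk => ?_⟩
  have hk4 : 4 ≤ k * (y * (1 - y)) := by
    rw [← div_le_iff₀ hxy]
    exact Nat.ceil_le.mp hk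
  have hkm : (k : ℝ) ≤ ((3 * k : ℕ) : ℝ) := by exact_mod_cast (by omega)
  have hky : ((3 * k : ℕ) : ℝ) * y ≤ k := by
    push_cast
    nlinarith [(Nat.cast_nonneg k : (0 : ℝ) ≤ k)]
  set m := 3 * k
  have hm0 : (0 : ℝ) ≤ m := Nat.cast_nonneg m
  have hv : 4 ≤ m * y * (1 - y) := by nlinarith
  have hm16 : (16 : ℝ) ≤ m := by
    have : y * (1 - y) ≤ 1 / 4 := by nlinarith [sq_nonneg (y - 1 / 2)]
    nlinarith
  have hmy : 4 ≤ m * y := by nlinarith [mul_nonneg hm0 h0.le]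
  have hcent : ((2 * m : ℕ) : ℝ) * (1 / 2) = m := by push_cast; ring
  have hcv : 4 ≤ ((2 * m : ℕ) : ℝ) * (1 / 2) * (1 - 1 / 2) := by rw [hcent]; linarith
  have c1 := binomWeight.le_mode (y := 1 / 2) (m := 2 * m) (p := m) (by norm_num) (by norm_num)
    hcv hcent.ge (by rw [hcent]; linarith)
  have c2 := binomWeight.mode_le (y := 1 / 2) (m := 2 * m) (p := m) (by norm_num) (by norm_num)
    hcv hcent.ge (by rw [hcent]; linarith)
  have s1 := binomWeight.le_sum_sq h0 (by linarith) hv hky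
  have s2 := binomWeight.sum_sq_le h0 (by linarith) hv (r := k) (by omega)
  rw [hcent] at c1 c2
  set B := binomWeight (1 / 2) (2 * m) m
  set S := ∑ q ∈ Finset.Ico 1 k, binomWeight y m q ^ 2
  have hsq : √(m * (1 - 1 / 2)) * √(m * y * (1 - y)) = m * w := by
    rw [← Real.sqrt_mul (by linarith), show (m : ℝ) * (1 - 1 / 2) * (m * y * (1 - y)) =
      (m : ℝ) ^ 2 * (y * (1 - y) / 2) by ring, Real.sqrt_mul (by positivity), Real.sqrt_sq hm0]
  have hprod : m * (B * S) * w = (√(m * (1 - 1 / 2)) * B) * (√(m * y * (1 - y)) * S) := by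
    linear_combination (-(B * S)) * hsq
  refine ⟨by linarith, ?_, ?_⟩
  · rw [div_le_iff₀ hw0, hprod]
    exact mul_le_mul c1 s1 (by norm_num) (by linarith)
  · rw [le_div_iff₀ hw0, hprod]
    exact mul_le_mul c2 s2 (by linarith) (by norm_num)

lemma factorial_div_mul_pow_eq (a b : ℝ) {m q : ℕ} (hq : q ≤ m) (hab : b = 1 / 2 - a) :
    ((2 * m).factorial : ℝ) / (((m - q).factorial : ℝ) ^ 2 * (q.factorial : ℝ) ^ 2) *
      a ^ (2 * m - 2 * q) * b ^ (2 * q) =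
    binomWeight (1 / 2) (2 * m) m * binomWeight (2 * b) m q ^ 2 := by
  have hx : 1 - 2 * b = 2 * a := by rw [hab]; ring
  obtain ⟨r, rfl⟩ := Nat.exists_eq_add_of_le hq
  unfold binomWeight
  rw [hx, Nat.cast_choose ℝ hq, Nat.cast_choose ℝ (by omega : q + r ≤ 2 * (q + r)),
    show 2 * (q + r) - 2 * q = 2 * r by omega, show 2 * (q + r) - (q + r) = q + r by omega,
    show q + r - q = r by omega, mul_pow 2 b, mul_pow 2 a, show (1 : ℝ) - 1 / 2 = 1 / 2 by norm_num]
  have e : ((1 / 2 : ℝ) ^ (q + r)) * 2 ^ q * 2 ^ r = 1 := by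
    rw [mul_assoc, ← pow_add, ← mul_pow]
    norm_num
  have f1 : (q.factorial : ℝ) ≠ 0 := by positivity
  have f2 : (r.factorial : ℝ) ≠ 0 := by positivity
  have f3 : ((q + r).factorial : ℝ) ≠ 0 := by positivity
  have hcoef : ((2 * (q + r)).factorial : ℝ) / (((q + r).factorial : ℝ) * (q + r).factorial) *
      (((q + r).factorial : ℝ) / (q.factorial * r.factorial)) ^ 2 =
      ((2 * (q + r)).factorial : ℝ) / ((r.factorial : ℝ) ^ 2 * (q.factorial : ℝ) ^ 2) := by
    field_simp
  calc _ = ((2 * (q + r)).factorial : ℝ) / ((r.factorial : ℝ) ^ 2 * (q.factorial : ℝ) ^ 2) *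
        a ^ (2 * r) * b ^ (2 * q) * (((1 / 2 : ℝ) ^ (q + r)) * 2 ^ q * 2 ^ r) ^ 2 := by
        rw [e]; ring
    _ = _ := by rw [← hcoef]; ring

lemma Aseq_six_mul {π₁ π₃ : ℝ} (τ : ℝ) (h1 : π₁ ≠ 0) (h3 : π₃ = 1 / 2 - π₁) {k : ℕ} :
    Aseq π₁ π₃ τ (6 * k) = binomWeight (1 / 2) (2 * (3 * k)) (3 * k) *
      (((3 * k : ℕ) : ℝ) * (π₁ * τ - 4 * π₃) *
          ∑ q ∈ Finset.Ico 1 k, binomWeight (2 * π₃) (3 * k) q ^ 2 -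
        (1 + τ / 2 - π₃ / π₁) * ∑ q ∈ Finset.Ico 1 k,
          binomWeight (2 * π₃) (3 * k) q ^ 2 * (q - ((3 * k : ℕ) : ℝ) * (2 * π₃))) := by
  have hset : Finset.Icc 1 (6 * k / 6 - 1) = Finset.Ico 1 k := by
    ext q
    simp only [Finset.mem_Icc, Finset.mem_Ico]
    omega
  rw [Aseq, hset, Finset.mul_sum, Finset.mul_sum, ← Finset.sum_sub_distrib, Finset.mul_sum]
  refine Finset.sum_congr rfl fun q hq => ?_
  rw [Finset.mem_Ico] at hq
  have h := factorial_div_mul_pow_eq π₁ π₃ (m := 3 * k) (q := q) (by omega) h3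
  rw [show 6 * k / 2 - q = 3 * k - q by omega, show 6 * k = 2 * (3 * k) by ring, h]
  have hlin : -(1 / 2) * ((-((2 * (3 * k) : ℕ) : ℝ) / 2 + q) * τ + 2 * q) +
      π₃ / π₁ * (-((2 * (3 * k) : ℕ) : ℝ) / 2 + q) =
      ((3 * k : ℕ) : ℝ) * (π₁ * τ - 4 * π₃) -
        (1 + τ / 2 - π₃ / π₁) * (q - ((3 * k : ℕ) : ℝ) * (2 * π₃)) := by
    push_cast
    rw [h3]
    field_simp
    ring
  rw [hlin]
  ring

lemma exists_abs_Aseq_sub_le {π₁ π₃ : ℝ} (τ : ℝ) (h0 : 0 < π₃) (h1 : π₃ ≤ 1 / 6)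
    (h3 : π₃ = 1 / 2 - π₁) {δ : ℝ} (hδ : 0 < δ) :
    ∃ α β : ℝ, 0 < α ∧ ∃ N : ℕ, ∀ n : ℕ, N < n → 6 ∣ n → ∃ P : ℝ, α ≤ P ∧ P ≤ β ∧
      |Aseq π₁ π₃ τ n - (π₁ * τ - 4 * π₃) * P| ≤ δ * P := by
  obtain ⟨α, β, hα, -, K, hK⟩ :=
    exists_bounds_central_mul_sum_sq (y := 2 * π₃) (by linarith) (by linarith)
  set s := 1 + τ / 2 - π₃ / π₁ with hs
  refine ⟨α, β, hα, 6 * (K + ⌈(|s| / δ) ^ 2⌉₊), ?_⟩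
  rintro _ hn ⟨k, rfl⟩
  have hk : K + ⌈(|s| / δ) ^ 2⌉₊ < k := by omega
  obtain ⟨hmy, hP1, hP2⟩ := hK k (by omega)
  refine ⟨_, hP1, hP2, ?_⟩
  rw [Aseq_six_mul τ (by linarith) h3, ← hs]
  have hky : ((3 * k : ℕ) : ℝ) * (2 * π₃) ≤ k := by
    push_cast
    nlinarith [(Nat.cast_nonneg k : (0 : ℝ) ≤ k)]
  have hD := binomWeight.abs_sum_sq_mul_dev_le (m := 3 * k) (r := k) (y := 2 * π₃) (by linarith)
    (by linarith) (by omega) (by omega) hmy hky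
  have hB := binomWeight.nonneg (y := 1 / 2) (by norm_num) (by norm_num) (2 * (3 * k)) (3 * k)
  have hsδ : |s| ≤ δ * √((3 * k : ℕ) : ℝ) := by
    rw [← div_le_iff₀' hδ]
    apply Real.le_sqrt_of_sq_le
    refine (Nat.le_ceil _).trans ?_
    exact_mod_cast (by omega)
  set m := 3 * k
  set B := binomWeight (1 / 2) (2 * m) m
  set S := ∑ q ∈ Finset.Ico 1 k, binomWeight (2 * π₃) m q ^ 2
  set D := ∑ q ∈ Finset.Ico 1 k, binomWeight (2 * π₃) m q ^ 2 * (q - (m : ℝ) * (2 * π₃))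
  have hS0 : 0 ≤ S := Finset.sum_nonneg fun q _ => sq_nonneg _
  have hmm : √(m : ℝ) * √(m : ℝ) = m := Real.mul_self_sqrt (Nat.cast_nonneg m)
  calc |B * (m * (π₁ * τ - 4 * π₃) * S - s * D) - (π₁ * τ - 4 * π₃) * (m * (B * S))|
      = B * (|s| * |D|) := by
        rw [show B * (m * (π₁ * τ - 4 * π₃) * S - s * D) - (π₁ * τ - 4 * π₃) * (m * (B * S)) =
          -(B * (s * D)) by ring, abs_neg, abs_mul, abs_mul, abs_of_nonneg hB]
    _ ≤ B * (δ * √(m : ℝ) * (√(m : ℝ) * S)) := by gcongr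
    _ = δ * (m * (B * S)) := by linear_combination (B * δ * S) * hmm

lemma exists_abs_Aseq_le_div {π₁ π₃ τ : ℝ} (h0 : 0 < π₃) (h1 : π₃ < 1 / 6)
    (h3 : π₃ = 1 / 2 - π₁) (hκ : π₁ * τ - 4 * π₃ = 0) :
    ∃ C : ℝ, 0 < C ∧ ∃ N : ℕ, ∀ n : ℕ, N < n → 6 ∣ n → |Aseq π₁ π₃ τ n| ≤ C / n := by
  obtain ⟨α, β, -, hβ, K, hK⟩ :=
    exists_bounds_central_mul_sum_sq (y := 2 * π₃) (by linarith) (by linarith)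
  set y := 2 * π₃ with hy
  set s := 1 + τ / 2 - π₃ / π₁ with hs
  set ε := 1 / 3 - y with hε
  have hε0 : 0 < ε := by linarith
  have hy0 : 0 < y := by linarith
  have hx : 0 < 1 - y := by linarith
  set E := 1 + 1 / ε ^ 4
  have hE0 : 0 < E := by positivity
  refine ⟨(|s| + 1) * (y * β + E) / (y * (1 - y)), by positivity, 6 * K, ?_⟩
  rintro _ hn ⟨k, rfl⟩
  obtain ⟨hmy, -, hP2⟩ := hK k (by omega)
  have hn0 : (0 : ℝ) < ((6 * k : ℕ) : ℝ) := Nat.cast_pos.mpr (by omega)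
  have hnm : ((6 * k : ℕ) : ℝ) = 2 * ((3 * k : ℕ) : ℝ) := by push_cast; ring
  have hky : ((3 * k : ℕ) : ℝ) * y + ((3 * k : ℕ) : ℝ) * ε ≤ k := by
    rw [← mul_add, hε]
    push_cast
    linarith
  rw [Aseq_six_mul τ (by linarith) h3, ← hs, hκ, ← hy, le_div_iff₀ hn0,
    le_div_iff₀ (by positivity), hnm]
  have hD := binomWeight.abs_sum_sq_mul_dev_le_of_lt (m := 3 * k) (r := k) hy0
    (by linarith) (by omega) (by omega) hmy hε0 hky
  have hB := binomWeight.nonneg (y := 1 / 2) (by norm_num) (by norm_num) (2 * (3 * k)) (3 * k)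
  have hB1 := binomWeight.le_one (y := 1 / 2) (by norm_num) (by norm_num)
    (by omega : 3 * k ≤ 2 * (3 * k))
  set m := 3 * k
  set B := binomWeight (1 / 2) (2 * m) m
  set S := ∑ q ∈ Finset.Ico 1 k, binomWeight y m q ^ 2
  set D := ∑ q ∈ Finset.Ico 1 k, binomWeight y m q ^ 2 * (q - (m : ℝ) * y)
  calc |B * (m * 0 * S - s * D)| * (2 * m) * (y * (1 - y))
      = |s| * (B * (2 * m * y * (1 - y) * |D|)) := by
        rw [show B * (m * 0 * S - s * D) = -(B * (s * D)) by ring, abs_neg, abs_mul, abs_mul,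
          abs_of_nonneg hB]
        ring
    _ ≤ |s| * (B * (m * y * S + E)) := by gcongr
    _ = |s| * (y * (m * (B * S)) + B * E) := by ring
    _ ≤ |s| * (y * β + 1 * E) := by gcongr
    _ ≤ (|s| + 1) * (y * β + E) := by
        rw [one_mul]
        gcongr
        linarith

/-- Trichotomy for the asymptotic sign and size of `A(n)` depending on whether
`π₁` is larger than, smaller than, or equal to `2/(4+τ)`. -/
theorem Aseq_trichotomy (π₁ π₃ τ : ℝ) (h1 : π₁ ∈ Set.Ico (1 / 3 : ℝ) (1 / 2))
    (h3 : π₃ = 1 / 2 - π₁) (hτ : τ ∈ Set.Icc (-1 : ℝ) 1) :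
    (2 / (4 + τ) < π₁ → ∃ c₁ c₂ : ℝ, 0 < c₁ ∧ c₁ ≤ c₂ ∧ ∃ N : ℕ,
        ∀ n : ℕ, N < n → 6 ∣ n → c₁ ≤ Aseq π₁ π₃ τ n ∧ Aseq π₁ π₃ τ n ≤ c₂) ∧
    (π₁ < 2 / (4 + τ) → ∃ c₁ c₂ : ℝ, 0 < c₁ ∧ c₁ ≤ c₂ ∧ ∃ N : ℕ,
        ∀ n : ℕ, N < n → 6 ∣ n → -c₂ ≤ Aseq π₁ π₃ τ n ∧ Aseq π₁ π₃ τ n ≤ -c₁) ∧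
    (π₁ = 2 / (4 + τ) → ∃ C : ℝ, 0 < C ∧ ∃ N : ℕ,
        ∀ n : ℕ, N < n → 6 ∣ n → |Aseq π₁ π₃ τ n| ≤ C / n) := by
  obtain ⟨h1a, h1b⟩ := h1
  obtain ⟨hτa, hτb⟩ := hτ
  have h4 : 0 < 4 + τ := by linarith
  refine ⟨fun h => ?_, fun h => ?_, fun h => ?_⟩
  · rw [div_lt_iff₀ h4] at h
    have hκ : 0 < π₁ * τ - 4 * π₃ := by linarith
    obtain ⟨α, β, hα, N, hN⟩ := exists_abs_Aseq_sub_le (π₁ := π₁) (π₃ := π₃) τ (by linarith)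
      (by linarith) h3 (half_pos hκ)
    set κ := π₁ * τ - 4 * π₃
    refine ⟨κ / 2 * α, max (κ / 2 * α) (3 / 2 * κ * β), by positivity, le_max_left _ _, N,
      fun n hn h6 => ?_⟩
    obtain ⟨P, hP1, hP2, hP⟩ := hN n hn h6
    rw [abs_le] at hP
    have e1 := mul_le_mul_of_nonneg_left hP1 hκ.le
    have e2 := mul_le_mul_of_nonneg_left hP2 hκ.le
    exact ⟨by linarith, le_max_of_le_right (by linarith)⟩
  · rw [lt_div_iff₀ h4] at h
    have hκ : 0 < -(π₁ * τ - 4 * π₃) := by linarith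
    obtain ⟨α, β, hα, N, hN⟩ := exists_abs_Aseq_sub_le (π₁ := π₁) (π₃ := π₃) τ (by linarith)
      (by linarith) h3 (half_pos hκ)
    set κ := π₁ * τ - 4 * π₃
    refine ⟨-κ / 2 * α, max (-κ / 2 * α) (3 / 2 * -κ * β), by positivity, le_max_left _ _, N,
      fun n hn h6 => ?_⟩
    obtain ⟨P, hP1, hP2, hP⟩ := hN n hn h6
    rw [abs_le] at hP
    have e1 := mul_le_mul_of_nonneg_left hP1 hκ.le
    have e2 := mul_le_mul_of_nonneg_left hP2 hκ.le
    exact ⟨neg_le.mp (le_max_of_le_right (by linarith)), by linarith⟩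
  · rw [eq_div_iff h4.ne'] at h
    exact exists_abs_Aseq_le_div (by linarith) (by nlinarith) h3 (by linarith)
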